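/- arXiv:2503.08151 — 3 statements merged into one kernel-verified Lean document; each statement's English description precedes it below -/
import Mathlib

section
/- For j = 1, 2 and every k ∈ ℝ, the vector w_j(k) = ( cs·sin²k + i·c·(c − s·cos k)·sin k , i·( −(−1)^j·√(1 − g(k)²) − s·(s − c·cos k)·sin k ) ) ∈ ℂ² satisfies M(k)·w_j(k) = λ_j(k)·w_j(k), where λ_j(k) = g(k) − (−1)^j·i·√(1 − g(k)²). -/
/-- The Fourier-transformed coin-shift operation `Û₁(k)` for parameter `θ`. -/
noncomputable def U1hat (θ k : ℝ) : Matrix (Fin 2) (Fin 2) ℂ :=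
  !![(Real.cos θ : ℂ) * (Real.cos k : ℂ),
     (Real.sin θ : ℂ) + Complex.I * (Real.cos θ : ℂ) * (Real.sin k : ℂ);
     (Real.sin θ : ℂ) - Complex.I * (Real.cos θ : ℂ) * (Real.sin k : ℂ),
     -((Real.cos θ : ℂ) * (Real.cos k : ℂ))]

/-- The Fourier-transformed coin-shift operation `Û₂(k)` for parameter `θ`. -/
noncomputable def U2hat (θ k : ℝ) : Matrix (Fin 2) (Fin 2) ℂ :=
  !![(Real.cos θ : ℂ), (Real.sin θ : ℂ) * Complex.exp (Complex.I * (k : ℂ));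
     (Real.sin θ : ℂ) * Complex.exp (-(Complex.I * (k : ℂ))), -(Real.cos θ : ℂ)]

/-- `g(k) = cos k + cos θ · sin θ · sin² k`. -/
noncomputable def gfun (θ k : ℝ) : ℝ :=
  Real.cos k + Real.cos θ * Real.sin θ * Real.sin k ^ 2

/-- The eigenvalue `λ_j(k) = g(k) − (−1)^j · i · √(1 − g(k)²)`, `j = 1, 2`. -/
noncomputable def lambdaj (θ : ℝ) (j : ℕ) (k : ℝ) : ℂ :=
  (gfun θ k : ℂ) - ((-1 : ℂ) ^ j) * Complex.I * (Real.sqrt (1 - gfun θ k ^ 2) : ℂ)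

/-- The (unnormalized) eigenvector `w_j(k)`, `j = 1, 2`. -/
noncomputable def wvec (θ : ℝ) (j : ℕ) (k : ℝ) : Fin 2 → ℂ :=
  ![((Real.cos θ * Real.sin θ * Real.sin k ^ 2 : ℝ) : ℂ) +
      Complex.I * (Real.cos θ : ℂ) *
        ((Real.cos θ - Real.sin θ * Real.cos k : ℝ) : ℂ) * (Real.sin k : ℂ),
    Complex.I * ((-((-1 : ℝ) ^ j) * Real.sqrt (1 - gfun θ k ^ 2)
      - Real.sin θ * (Real.sin θ - Real.cos θ * Real.cos k) * Real.sin k : ℝ) : ℂ)]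

/-- The entries of `Û₂(k)Û₁(k)` in the first row have squared moduli summing to one, which
expresses `1 - g(k)²` as a sum of squares. -/
theorem one_sub_gfun_sq (θ k : ℝ) :
    1 - gfun θ k ^ 2 =
      (Real.sin θ * (Real.sin θ - Real.cos θ * Real.cos k) * Real.sin k) ^ 2 +
        (Real.cos θ * Real.sin θ * Real.sin k ^ 2) ^ 2 +
        (Real.cos θ * (Real.cos θ - Real.sin θ * Real.cos k) * Real.sin k) ^ 2 := by
  have h1 := Real.sin_sq_add_cos_sq θ
  have h2 := Real.sin_sq_add_cos_sq k
  unfold gfun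
  grind

theorem gfun_sq_le_one (θ k : ℝ) : gfun θ k ^ 2 ≤ 1 := by
  have h := one_sub_gfun_sq θ k
  have : 0 ≤ 1 - gfun θ k ^ 2 := by rw [h]; positivity
  linarith

/-- For `j = 1, 2` and every `k ∈ ℝ`, the vector `w_j(k)` satisfies
`M(k)·w_j(k) = λ_j(k)·w_j(k)` where `M(k) = Û₂(k)Û₁(k)`. -/
theorem wvec_eigenvector (θ : ℝ) (hθ : θ ∈ Set.Ioo 0 Real.pi) (hθ' : θ ≠ Real.pi / 2)
    (j : ℕ) (hj : j = 1 ∨ j = 2) (k : ℝ) :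
    (U2hat θ k * U1hat θ k).mulVec (wvec θ j k) = lambdaj θ j k • wvec θ j k := by
  have hR : (Real.sqrt (1 - gfun θ k ^ 2) : ℂ) ^ 2 = 1 - (gfun θ k : ℂ) ^ 2 := by
    exact_mod_cast Real.sq_sqrt (sub_nonneg.mpr (gfun_sq_le_one θ k))
  have he : Complex.exp (Complex.I * (k : ℂ)) = Real.cos k + Real.sin k * Complex.I := by
    rw [mul_comm, Complex.exp_mul_I, Complex.ofReal_cos, Complex.ofReal_sin]
  have he' : Complex.exp (-(Complex.I * (k : ℂ))) = Real.cos k - Real.sin k * Complex.I := by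
    rw [mul_comm, ← neg_mul, Complex.exp_mul_I, Complex.cos_neg, Complex.sin_neg,
      Complex.ofReal_cos, Complex.ofReal_sin]
    ring
  have h1 : (Real.sin θ : ℂ) ^ 2 + (Real.cos θ : ℂ) ^ 2 = 1 := by
    exact_mod_cast Real.sin_sq_add_cos_sq θ
  have h2 : (Real.sin k : ℂ) ^ 2 + (Real.cos k : ℂ) ^ 2 = 1 := by
    exact_mod_cast Real.sin_sq_add_cos_sq k
  have hg : (gfun θ k : ℂ) =
      Real.cos k + Real.cos θ * Real.sin θ * (Real.sin k : ℂ) ^ 2 := by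
    simp only [gfun, Complex.ofReal_add, Complex.ofReal_mul, Complex.ofReal_pow]
  have hI := Complex.I_sq
  have hε : ((-1 : ℂ) ^ j) ^ 2 = 1 := by rw [← pow_mul, mul_comm, pow_mul]; simp
  simp only [U1hat, U2hat, wvec, lambdaj, he, he', Complex.ofReal_sub,
    Complex.ofReal_mul, Complex.ofReal_pow, Complex.ofReal_neg, Complex.ofReal_one]
  generalize (Real.sqrt (1 - gfun θ k ^ 2) : ℂ) = R at *
  generalize (gfun θ k : ℂ) = g at *
  generalize (Real.cos θ : ℂ) = c at *
  generalize (Real.sin θ : ℂ) = s at *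
  generalize (Real.cos k : ℂ) = x at *
  generalize (Real.sin k : ℂ) = y at *
  generalize ((-1 : ℂ) ^ j) = ε at *
  generalize Complex.I = i at *
  subst hg
  ext a
  fin_cases a
  · simp [Matrix.mulVec, dotProduct, Matrix.mul_apply, Fin.sum_univ_two]
    grind
  · simp [Matrix.mulVec, dotProduct, Matrix.mul_apply, Fin.sum_univ_two]
    grind
end

section
/- Assume θ ≠ π/4 and θ ≠ 3π/4. Then the function h is strictly monotone on the interval [0,π] (strictly increasing when cs > 0 and strictly decreasing when cs < 0), with boundary values h(0) = √(1 − 2cs) and h(π) = √(1 + 2cs). -/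
/-- `h(k) = (1 − 2cs·cos k)/√((1 − cs − cs·cos k)(1 + cs − cs·cos k))`. -/
noncomputable def hfun (θ k : ℝ) : ℝ :=
  (1 - 2 * (Real.cos θ * Real.sin θ) * Real.cos k) /
    Real.sqrt ((1 - Real.cos θ * Real.sin θ - Real.cos θ * Real.sin θ * Real.cos k) *
      (1 + Real.cos θ * Real.sin θ - Real.cos θ * Real.sin θ * Real.cos k))

theorem four_mul_sq_cos_mul_sin_lt_one {θ : ℝ} (hθ : θ ∈ Set.Ioo 0 Real.pi)
    (hθ4 : θ ≠ Real.pi / 4) (hθ34 : θ ≠ 3 * Real.pi / 4) :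
    4 * (Real.cos θ * Real.sin θ) ^ 2 < 1 := by
  have hne : Real.cos (2 * θ) ≠ 0 := by
    intro h
    obtain ⟨n, hn⟩ := Real.cos_eq_zero_iff.mp h
    have hpi := Real.pi_pos
    obtain ⟨h0, h1⟩ := hθ
    have hn0 : (-1 : ℝ) < n := by
      by_contra! hc
      nlinarith
    have hn2 : (n : ℝ) < 2 := by
      by_contra! hc
      nlinarith
    have hn0' : -1 < n := by exact_mod_cast hn0
    have hn2' : n < 2 := by exact_mod_cast hn2
    interval_cases n
    · exact hθ4 (by push_cast at hn; linarith)
    · exact hθ34 (by push_cast at hn; linarith)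
  have hpos : 0 < Real.cos (2 * θ) ^ 2 := by positivity
  have hsin : (2 * Real.sin θ * Real.cos θ) ^ 2 + Real.cos (2 * θ) ^ 2 = 1 := by
    rw [← Real.sin_two_mul]
    exact Real.sin_sq_add_cos_sq (2 * θ)
  linarith [hsin, show (2 * Real.sin θ * Real.cos θ) ^ 2
    = 4 * (Real.cos θ * Real.sin θ) ^ 2 by ring]

theorem strictMonoOn_div_sqrt_sq_sub_sq {a : ℝ} (ha : 4 * a ^ 2 < 1) :
    StrictMonoOn (fun p : ℝ => (2 * p - 1) / Real.sqrt (p ^ 2 - a ^ 2)) (Set.Ioi (1 / 2)) := by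
  intro p hp q hq hpq
  rw [Set.mem_Ioi] at hp hq
  have hP : 0 < p ^ 2 - a ^ 2 := by nlinarith
  have hQ : 0 < q ^ 2 - a ^ 2 := by nlinarith
  have hq1 : 0 < 2 * q - 1 := by linarith
  have hp1 : 0 < 2 * p - 1 := by linarith
  change (2 * p - 1) / Real.sqrt (p ^ 2 - a ^ 2) < (2 * q - 1) / Real.sqrt (q ^ 2 - a ^ 2)
  rw [div_lt_div_iff₀ (Real.sqrt_pos.mpr hP) (Real.sqrt_pos.mpr hQ)]
  refine lt_of_pow_lt_pow_left₀ 2 (by positivity) ?_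
  rw [mul_pow, mul_pow, Real.sq_sqrt hP.le, Real.sq_sqrt hQ.le]
  have hfac : 0 < 4 * p * q - p - q - 4 * a ^ 2 * (p + q - 1) := by
    have h1 : 0 < (1 - 4 * a ^ 2) * (p + q - 1) := mul_pos (by linarith) (by linarith)
    linarith [mul_pos hp1 hq1]
  linarith [mul_pos (sub_pos.mpr hpq) hfac]

theorem hfun_eq_div_sqrt_sq_sub_sq (θ k : ℝ) :
    hfun θ k = (2 * (1 - Real.cos θ * Real.sin θ * Real.cos k) - 1) /
      Real.sqrt ((1 - Real.cos θ * Real.sin θ * Real.cos k) ^ 2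
        - (Real.cos θ * Real.sin θ) ^ 2) := by
  unfold hfun
  congr 1
  · ring
  · congr 1
    ring

theorem one_sub_mul_cos_mem_Ioi {a : ℝ} (ha : 4 * a ^ 2 < 1) (k : ℝ) :
    1 - a * Real.cos k ∈ Set.Ioi (1 / 2 : ℝ) := by
  have h : |a * Real.cos k| < 1 / 2 := by
    refine abs_lt_of_sq_lt_sq ?_ (by norm_num)
    nlinarith [Real.cos_sq_le_one k, sq_nonneg a]
  rw [Set.mem_Ioi]
  linarith [(abs_lt.mp h).2]

/-- If `θ ≠ π/4, 3π/4`, then `h` is strictly monotone on `[0, π]`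
(strictly increasing when `cs > 0`, strictly decreasing when `cs < 0`),
with boundary values `h(0) = √(1 − 2cs)` and `h(π) = √(1 + 2cs)`. -/
theorem hfun_strict_monotone (θ : ℝ) (hθ : θ ∈ Set.Ioo 0 Real.pi) (hθ' : θ ≠ Real.pi / 2)
    (hθ4 : θ ≠ Real.pi / 4) (hθ34 : θ ≠ 3 * Real.pi / 4) :
    (0 < Real.cos θ * Real.sin θ → StrictMonoOn (hfun θ) (Set.Icc 0 Real.pi)) ∧
    (Real.cos θ * Real.sin θ < 0 → StrictAntiOn (hfun θ) (Set.Icc 0 Real.pi)) ∧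
    hfun θ 0 = Real.sqrt (1 - 2 * (Real.cos θ * Real.sin θ)) ∧
    hfun θ Real.pi = Real.sqrt (1 + 2 * (Real.cos θ * Real.sin θ)) := by
  have ha := four_mul_sq_cos_mul_sin_lt_one hθ hθ4 hθ34
  refine ⟨fun hpos x hx y hy hxy => ?_, fun hneg x hx y hy hxy => ?_, ?_, ?_⟩
  · rw [hfun_eq_div_sqrt_sq_sub_sq, hfun_eq_div_sqrt_sq_sub_sq]
    exact strictMonoOn_div_sqrt_sq_sub_sq ha (one_sub_mul_cos_mem_Ioi ha x)
      (one_sub_mul_cos_mem_Ioi ha y)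
      (sub_lt_sub_left (mul_lt_mul_of_pos_left (Real.strictAntiOn_cos hx hy hxy) hpos) 1)
  · rw [hfun_eq_div_sqrt_sq_sub_sq, hfun_eq_div_sqrt_sq_sub_sq]
    exact strictMonoOn_div_sqrt_sq_sub_sq ha (one_sub_mul_cos_mem_Ioi ha y)
      (one_sub_mul_cos_mem_Ioi ha x)
      (sub_lt_sub_left (mul_lt_mul_of_neg_left (Real.strictAntiOn_cos hx hy hxy) hneg) 1)
  · rw [hfun, Real.cos_zero]
    refine Eq.trans ?_ Real.div_sqrt
    congr 1
    · ring
    · congr 1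
      ring
  · rw [hfun, Real.cos_pi]
    refine Eq.trans ?_ Real.div_sqrt
    congr 1
    · ring
    · congr 1
      ring
end

section
/- Assume θ ≠ π/4 and θ ≠ 3π/4. Then for every k ∈ (0,π), h is differentiable at k and h′(k) = ( c·(4 − h(k)²)·√(D(h(k)))·√(W₊(h(k)))·√(W₋(h(k))) ) / ( |c|·( h(k) + 2·√(D(h(k))) )² ). -/
/-- `D(x) = 1 − 4c²s² + c²s²x²`. -/
noncomputable def Dfun (θ x : ℝ) : ℝ :=
  1 - 4 * Real.cos θ ^ 2 * Real.sin θ ^ 2 + Real.cos θ ^ 2 * Real.sin θ ^ 2 * x ^ 2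

/-- `W₊(x) = −2(1 − 2|c|s) + (1 − |c|s)x² + x√(D(x))`. -/
noncomputable def Wplus (θ x : ℝ) : ℝ :=
  -2 * (1 - 2 * |Real.cos θ| * Real.sin θ) + (1 - |Real.cos θ| * Real.sin θ) * x ^ 2 +
    x * Real.sqrt (Dfun θ x)

/-- `W₋(x) = 2(1 + 2|c|s) − (1 + |c|s)x² − x√(D(x))`. -/
noncomputable def Wminus (θ x : ℝ) : ℝ :=
  2 * (1 + 2 * |Real.cos θ| * Real.sin θ) - (1 + |Real.cos θ| * Real.sin θ) * x ^ 2 -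
    x * Real.sqrt (Dfun θ x)

theorem abs_cos_mul_sin_lt_half {θ : ℝ} (hθ : θ ∈ Set.Ioo 0 Real.pi)
    (hθ4 : θ ≠ Real.pi / 4) (hθ34 : θ ≠ 3 * Real.pi / 4) :
    |Real.cos θ * Real.sin θ| < 1 / 2 := by
  have hcos : Real.cos (2 * θ) ≠ 0 := by
    intro h
    obtain ⟨n, hn⟩ := Real.cos_eq_zero_iff.mp h
    have hpi := Real.pi_pos
    have h0 : (-1 : ℝ) < n := by
      by_contra! hle
      nlinarith [hθ.1]
    have h2 : (n : ℝ) < 2 := by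
      by_contra! hle
      nlinarith [hθ.2]
    have h0' : -1 < n := by exact_mod_cast h0
    have h2' : n < 2 := by exact_mod_cast h2
    obtain rfl | rfl : n = 0 ∨ n = 1 := by omega
    · apply hθ4
      push_cast at hn
      linarith
    · apply hθ34
      push_cast at hn
      linarith
  have hpos := pow_pos (abs_pos.mpr hcos) 2
  rw [sq_abs, Real.cos_two_mul] at hpos
  apply abs_lt_of_sq_lt_sq _ (by norm_num)
  nlinarith [Real.sin_sq_add_cos_sq θ, Real.sin_sq θ]

theorem abs_mul_cos_lt_half {a : ℝ} (ha : |a| < 1 / 2) (k : ℝ) : |a * Real.cos k| < 1 / 2 := by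
  rw [abs_mul]
  exact (mul_le_of_le_one_right (abs_nonneg a) (Real.abs_cos_le_one k)).trans_lt ha

theorem radicand_pos {a u : ℝ} (ha : |a| < 1 / 2) (hu : |u| < 1 / 2) :
    0 < (1 - a - u) * (1 + a - u) := by
  rw [abs_lt] at ha hu
  exact mul_pos (by linarith) (by linarith)

theorem hasDerivAt_ratio {a k : ℝ}
    (hP : 0 < (1 - a - a * Real.cos k) * (1 + a - a * Real.cos k)) :
    HasDerivAt (fun k => (1 - 2 * a * Real.cos k) /
        √((1 - a - a * Real.cos k) * (1 + a - a * Real.cos k)))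
      (a * Real.sin k * (1 - a * Real.cos k - 2 * a ^ 2) /
        √((1 - a - a * Real.cos k) * (1 + a - a * Real.cos k)) ^ 3) k := by
  have hc := Real.hasDerivAt_cos k
  have hN := (hc.const_mul (2 * a)).const_sub 1
  have hu := hc.const_mul a
  have hS := ((hu.const_sub (1 - a)).mul (hu.const_sub (1 + a))).sqrt hP.ne'
  have hS0 := Real.sqrt_pos.mpr hP
  refine (hN.div hS hS0.ne').congr_deriv ?_
  have hsq := Real.sq_sqrt hP.le
  simp only [Pi.mul_apply]
  generalize √((1 - a - a * Real.cos k) * (1 + a - a * Real.cos k)) = S at hS0 hsq ⊢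
  field_simp
  rw [hsq]
  ring

theorem sqrt_Dfun_of_eq {θ a u S : ℝ} (haθ : Real.cos θ * Real.sin θ = a) (hS : 0 < S)
    (hsq : S ^ 2 = (1 - a - u) * (1 + a - u)) (hnn : 0 ≤ 1 - u - 2 * a ^ 2) :
    √(Dfun θ ((1 - 2 * u) / S)) = (1 - u - 2 * a ^ 2) / S := by
  have hD : Dfun θ ((1 - 2 * u) / S) = ((1 - u - 2 * a ^ 2) / S) ^ 2 := by
    have h : Dfun θ ((1 - 2 * u) / S) = 1 - 4 * a ^ 2 + a ^ 2 * ((1 - 2 * u) / S) ^ 2 := by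
      rw [Dfun, ← haθ]
      ring
    rw [h]
    field_simp
    linear_combination (1 - 4 * a ^ 2) * hsq
  rw [hD, Real.sqrt_sq (by positivity)]

/-- If `θ ≠ π/4, 3π/4`, then for every `k ∈ (0, π)`, `h` is differentiable at `k` with
`h′(k) = c(4 − h(k)²)√(D(h(k)))√(W₊(h(k)))√(W₋(h(k))) / (|c|(h(k) + 2√(D(h(k))))²)`. -/
theorem hfun_hasDerivAt (θ : ℝ) (hθ : θ ∈ Set.Ioo 0 Real.pi) (hθ' : θ ≠ Real.pi / 2)
    (hθ4 : θ ≠ Real.pi / 4) (hθ34 : θ ≠ 3 * Real.pi / 4)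
    (k : ℝ) (hk : k ∈ Set.Ioo 0 Real.pi) :
    HasDerivAt (hfun θ)
      (Real.cos θ * (4 - hfun θ k ^ 2) * Real.sqrt (Dfun θ (hfun θ k)) *
          Real.sqrt (Wplus θ (hfun θ k)) * Real.sqrt (Wminus θ (hfun θ k)) /
        (|Real.cos θ| * (hfun θ k + 2 * Real.sqrt (Dfun θ (hfun θ k))) ^ 2)) k := by
  have ha := abs_cos_mul_sin_lt_half hθ hθ4 hθ34
  have hs : 0 < Real.sin θ := Real.sin_pos_of_pos_of_lt_pi hθ.1 hθ.2
  have hsk : 0 < Real.sin k := Real.sin_pos_of_pos_of_lt_pi hk.1 hk.2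
  have hc : Real.cos θ ≠ 0 := by
    intro h
    exact hθ' (Real.injOn_cos ⟨hθ.1.le, hθ.2.le⟩
      ⟨by linarith [Real.pi_pos], by linarith [Real.pi_pos]⟩ (by rw [h, Real.cos_pi_div_two]))
  have hb : |Real.cos θ| * Real.sin θ = |Real.cos θ * Real.sin θ| := by
    rw [abs_mul, abs_of_pos hs]
  obtain ⟨a, haθ⟩ : ∃ a, Real.cos θ * Real.sin θ = a := ⟨_, rfl⟩
  rw [haθ] at ha hb
  have hu := abs_mul_cos_lt_half ha k
  have hP := radicand_pos ha hu
  have hfun_eq : hfun θ = fun k => (1 - 2 * a * Real.cos k) /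
      √((1 - a - a * Real.cos k) * (1 + a - a * Real.cos k)) := by
    funext k
    rw [hfun, haθ]
  have hbu : |a * Real.cos k| ≤ |a| := by
    rw [abs_mul]
    exact mul_le_of_le_one_right (abs_nonneg a) (Real.abs_cos_le_one k)
  have hbsin : (|a| * Real.sin k) ^ 2 = (|a| - a * Real.cos k) * (|a| + a * Real.cos k) := by
    rw [mul_pow, sq_abs, Real.sin_sq]
    linear_combination -sq_abs a
  have hder := hasDerivAt_ratio hP
  rw [← hfun_eq] at hder
  refine hder.congr_deriv ?_
  have hS := Real.sqrt_pos.mpr hP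
  have hsq := Real.sq_sqrt hP.le
  have hx : hfun θ k = (1 - 2 * (a * Real.cos k)) /
      √((1 - a - a * Real.cos k) * (1 + a - a * Real.cos k)) := by
    rw [hfun, haθ]
    ring_nf
  generalize √((1 - a - a * Real.cos k) * (1 + a - a * Real.cos k)) = S at hS hsq hx ⊢
  generalize a * Real.cos k = u at hu hbu hbsin hsq hx ⊢
  have hb0 := abs_nonneg a
  have hub := abs_le.mp hbu
  have hu' := abs_lt.mp hu
  have hnn : 0 ≤ 1 - u - 2 * a ^ 2 := by nlinarith [sq_abs a]
  have hE : 0 < 3 - 4 * u - 4 * a ^ 2 := by nlinarith [sq_abs a]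
  have hsD := sqrt_Dfun_of_eq haθ hS hsq hnn
  have hWp : Wplus θ ((1 - 2 * u) / S) =
      (|a| - u) * ((3 - 4 * u - 4 * a ^ 2) / S ^ 2) := by
    have hexp : Wplus θ ((1 - 2 * u) / S) = -2 * (1 - 2 * |a|) +
        (1 - |a|) * ((1 - 2 * u) / S) ^ 2 +
        ((1 - 2 * u) / S) * ((1 - u - 2 * a ^ 2) / S) := by
      rw [Wplus, hsD, ← hb]
      ring
    rw [hexp]
    field_simp
    rw [hsq]
    ring
  have hWm : Wminus θ ((1 - 2 * u) / S) =
      (|a| + u) * ((3 - 4 * u - 4 * a ^ 2) / S ^ 2) := by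
    have hexp : Wminus θ ((1 - 2 * u) / S) = 2 * (1 + 2 * |a|) -
        (1 + |a|) * ((1 - 2 * u) / S) ^ 2 -
        ((1 - 2 * u) / S) * ((1 - u - 2 * a ^ 2) / S) := by
      rw [Wminus, hsD, ← hb]
      ring
    rw [hexp]
    field_simp
    rw [hsq]
    ring
  have hWW : √(Wplus θ ((1 - 2 * u) / S)) * √(Wminus θ ((1 - 2 * u) / S)) =
      |a| * Real.sin k * ((3 - 4 * u - 4 * a ^ 2) / S ^ 2) := by
    have hF : 0 ≤ (3 - 4 * u - 4 * a ^ 2) / S ^ 2 := by positivity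
    rw [← Real.sqrt_mul (by rw [hWp]; exact mul_nonneg (by linarith) hF), hWp, hWm,
      ← Real.sqrt_sq (show 0 ≤ |a| * Real.sin k * ((3 - 4 * u - 4 * a ^ 2) / S ^ 2) by positivity)]
    congr 1
    linear_combination -((3 - 4 * u - 4 * a ^ 2) / S ^ 2) ^ 2 * hbsin
  have h4 : 4 - ((1 - 2 * u) / S) ^ 2 = (3 - 4 * u - 4 * a ^ 2) / S ^ 2 := by
    field_simp
    rw [hsq]
    ring
  have hden : (1 - 2 * u) / S + 2 * ((1 - u - 2 * a ^ 2) / S) =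
      (3 - 4 * u - 4 * a ^ 2) / S := by
    ring
  rw [hx, mul_assoc _ (√(Wplus _ _)), hWW, hsD, h4, hden, ← hb, ← haθ]
  rw [← haθ] at hE
  have hc' := abs_pos.mpr hc
  generalize 3 - 4 * u - 4 * (Real.cos θ * Real.sin θ) ^ 2 = E at hE ⊢
  field_simp
end
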